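/- arXiv:1205.4871 — 2 statements merged into one kernel-verified Lean document; each statement's English description precedes it below -/
import Mathlib

section
/- Let F be the following set of 12 four-element subsets of {1,...,7}: {1,2,4,6}, {1,2,5,6}, {1,2,5,7}, {1,2,4,7}, {1,3,4,6}, {1,3,5,6}, {1,3,5,7}, {1,3,4,7}, {2,3,4,6}, {2,3,5,6}, {2,3,5,7}, {2,3,4,7} (the facets of the triangulation P^7_3 of the 3-sphere). Then the group of permutations σ of {1,...,7} such that σ maps every member of F to a member of F is isomorphic to the direct product of the dihedral group of order 8 and the dihedral group of order 6; in particular it has order 48. -/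
namespace P73

/-- The rotation of the 4-cycle `3-5-4-6`. -/
def rho4 : Equiv.Perm (Fin 7) :=
  ⟨![0, 1, 2, 5, 6, 4, 3], ![0, 1, 2, 6, 5, 3, 4], by decide, by decide⟩

/-- A reflection of the 4-cycle `3-5-4-6`. -/
def ref4 : Equiv.Perm (Fin 7) :=
  ⟨![0, 1, 2, 4, 3, 5, 6], ![0, 1, 2, 4, 3, 5, 6], by decide, by decide⟩

/-- The rotation of the triangle `0-1-2`. -/
def rho3 : Equiv.Perm (Fin 7) :=
  ⟨![1, 2, 0, 3, 4, 5, 6], ![2, 0, 1, 3, 4, 5, 6], by decide, by decide⟩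

/-- A reflection of the triangle `0-1-2`. -/
def ref3 : Equiv.Perm (Fin 7) :=
  ⟨![1, 0, 2, 3, 4, 5, 6], ![1, 0, 2, 3, 4, 5, 6], by decide, by decide⟩

def fun4 : DihedralGroup 4 → Equiv.Perm (Fin 7)
  | .r i => rho4 ^ (ZMod.val i)
  | .sr i => ref4 * rho4 ^ (ZMod.val i)

def fun3 : DihedralGroup 3 → Equiv.Perm (Fin 7)
  | .r i => rho3 ^ (ZMod.val i)
  | .sr i => ref3 * rho3 ^ (ZMod.val i)

set_option maxRecDepth 100000

theorem fun4_mul (a b : DihedralGroup 4) : fun4 (a * b) = fun4 a * fun4 b := by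
  rcases a with i | i <;> rcases b with j | j <;> revert i j <;> decide

theorem fun3_mul (a b : DihedralGroup 3) : fun3 (a * b) = fun3 a * fun3 b := by
  rcases a with i | i <;> rcases b with j | j <;> revert i j <;> decide

def hom4 : DihedralGroup 4 →* Equiv.Perm (Fin 7) := MonoidHom.mk' fun4 fun4_mul

def hom3 : DihedralGroup 3 →* Equiv.Perm (Fin 7) := MonoidHom.mk' fun3 fun3_mul

theorem hom_comm (a : DihedralGroup 4) (b : DihedralGroup 3) :
    Commute (hom4 a) (hom3 b) := by
  show fun4 a * fun3 b = fun3 b * fun4 a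
  rcases a with i | i <;> rcases b with j | j <;> revert i j <;> decide

def hom : DihedralGroup 4 × DihedralGroup 3 →* Equiv.Perm (Fin 7) :=
  MonoidHom.noncommCoprod hom4 hom3 hom_comm

theorem hom_apply (a : DihedralGroup 4) (b : DihedralGroup 3) :
    hom (a, b) = fun4 a * fun3 b := rfl

theorem hom_injective : Function.Injective hom := by
  rw [injective_iff_map_eq_one]
  rintro ⟨a, b⟩ h
  rw [hom_apply] at h
  rcases a with i | i <;> rcases b with j | j <;> revert i j <;> decide

def facets : Finset (Finset (Fin 7)) :=
  {({0, 1, 3, 5} : Finset (Fin 7)), {0, 1, 4, 5}, {0, 1, 4, 6},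
      {0, 1, 3, 6}, {0, 2, 3, 5}, {0, 2, 4, 5}, {0, 2, 4, 6}, {0, 2, 3, 6},
      {1, 2, 3, 5}, {1, 2, 4, 5}, {1, 2, 4, 6}, {1, 2, 3, 6}}

theorem fun4_mem (a : DihedralGroup 4) : ∀ s ∈ facets, s.image (fun4 a) ∈ facets := by
  rcases a with i | i <;> revert i <;> decide

theorem fun3_mem (a : DihedralGroup 3) : ∀ s ∈ facets, s.image (fun3 a) ∈ facets := by
  rcases a with i | i <;> revert i <;> decide

/-- The missing edges are exactly `34` and `56`. -/
theorem missing : ∀ a b : Fin 7, a ≠ b → (∀ s ∈ facets, a ∈ s → b ∉ s) →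
    (a = 3 ∧ b = 4) ∨ (a = 4 ∧ b = 3) ∨ (a = 5 ∧ b = 6) ∨ (a = 6 ∧ b = 5) := by
  decide

theorem missing34 : ∀ s ∈ facets, (3 : Fin 7) ∈ s → (4 : Fin 7) ∉ s := by decide

theorem missing56 : ∀ s ∈ facets, (5 : Fin 7) ∈ s → (6 : Fin 7) ∉ s := by decide

theorem fun4_fix (a : DihedralGroup 4) : fun4 a 0 = 0 ∧ fun4 a 1 = 1 ∧ fun4 a 2 = 2 := by
  rcases a with i | i <;> revert i <;> decide

theorem fun3_fix (a : DihedralGroup 3) :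
    fun3 a 3 = 3 ∧ fun3 a 4 = 4 ∧ fun3 a 5 = 5 ∧ fun3 a 6 = 6 := by
  rcases a with i | i <;> revert i <;> decide

theorem fun3_maps (a : DihedralGroup 3) :
    fun3 a 0 < 3 ∧ fun3 a 1 < 3 ∧ fun3 a 2 < 3 := by
  rcases a with i | i <;> revert i <;> decide

theorem fun4_fix_lt (a : DihedralGroup 4) (x : Fin 7) (hx : x < 3) : fun4 a x = x := by
  obtain ⟨h0, h1, h2⟩ := fun4_fix a
  have : x = 0 ∨ x = 1 ∨ x = 2 := by revert x; decide
  rcases this with rfl | rfl | rfl <;> assumption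

theorem exists3 : ∀ a b c : Fin 7, a < 3 → b < 3 → c < 3 → a ≠ b → a ≠ c → b ≠ c →
    ∃ g : DihedralGroup 3, fun3 g 0 = a ∧ fun3 g 1 = b ∧ fun3 g 2 = c := by
  have key : ∀ a b c : Fin 7, a < 3 → b < 3 → c < 3 → a ≠ b → a ≠ c → b ≠ c →
    (∃ i : ZMod 3, fun3 (.r i) 0 = a ∧ fun3 (.r i) 1 = b ∧ fun3 (.r i) 2 = c) ∨
    (∃ i : ZMod 3, fun3 (.sr i) 0 = a ∧ fun3 (.sr i) 1 = b ∧ fun3 (.sr i) 2 = c) := by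
    decide
  intro a b c h1 h2 h3 h4 h5 h6
  rcases key a b c h1 h2 h3 h4 h5 h6 with ⟨i, h⟩ | ⟨i, h⟩
  exacts [⟨_, h⟩, ⟨_, h⟩]

theorem exists4 (a b c d : Fin 7)
    (h1 : (a = 3 ∧ b = 4) ∨ (a = 4 ∧ b = 3) ∨ (a = 5 ∧ b = 6) ∨ (a = 6 ∧ b = 5))
    (h2 : (c = 3 ∧ d = 4) ∨ (c = 4 ∧ d = 3) ∨ (c = 5 ∧ d = 6) ∨ (c = 6 ∧ d = 5))
    (hac : a ≠ c) (had : a ≠ d) :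
    ∃ g : DihedralGroup 4, fun4 g 3 = a ∧ fun4 g 4 = b ∧ fun4 g 5 = c ∧ fun4 g 6 = d := by
  have key : (∃ i : ZMod 4, fun4 (.r i) 3 = a ∧ fun4 (.r i) 4 = b ∧ fun4 (.r i) 5 = c ∧
        fun4 (.r i) 6 = d) ∨
      (∃ i : ZMod 4, fun4 (.sr i) 3 = a ∧ fun4 (.sr i) 4 = b ∧ fun4 (.sr i) 5 = c ∧
        fun4 (.sr i) 6 = d) := by
    rcases h1 with ⟨rfl, rfl⟩ | ⟨rfl, rfl⟩ | ⟨rfl, rfl⟩ | ⟨rfl, rfl⟩ <;>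
    rcases h2 with ⟨rfl, rfl⟩ | ⟨rfl, rfl⟩ | ⟨rfl, rfl⟩ | ⟨rfl, rfl⟩ <;>
    first
    | exact absurd rfl hac
    | exact absurd rfl had
    | decide
  rcases key with ⟨i, h⟩ | ⟨i, h⟩
  exacts [⟨_, h⟩, ⟨_, h⟩]

theorem image_missing (σ : Equiv.Perm (Fin 7))
    (hinv : ∀ s ∈ facets, s.image (σ⁻¹ : Equiv.Perm (Fin 7)) ∈ facets) (a b : Fin 7)
    (hab : ∀ s ∈ facets, a ∈ s → b ∉ s) : ∀ s ∈ facets, σ a ∈ s → σ b ∉ s := by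
  intro s hs ha hb
  refine hab _ (hinv s hs) ?_ ?_
  · exact Finset.mem_image.2 ⟨σ a, ha, by simp⟩
  · exact Finset.mem_image.2 ⟨σ b, hb, by simp⟩

theorem lt_three (a b c d x : Fin 7)
    (h1 : (a = 3 ∧ b = 4) ∨ (a = 4 ∧ b = 3) ∨ (a = 5 ∧ b = 6) ∨ (a = 6 ∧ b = 5))
    (h2 : (c = 3 ∧ d = 4) ∨ (c = 4 ∧ d = 3) ∨ (c = 5 ∧ d = 6) ∨ (c = 6 ∧ d = 5))
    (hac : a ≠ c) (had : a ≠ d) (ha : x ≠ a) (hb : x ≠ b) (hc : x ≠ c) (hd : x ≠ d) :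
    x < 3 := by
  omega

theorem mem_range (σ : Equiv.Perm (Fin 7))
    (hinv : ∀ s ∈ facets, s.image (σ⁻¹ : Equiv.Perm (Fin 7)) ∈ facets) :
    ∃ x, hom x = σ := by
  have hne : ∀ a b : Fin 7, a ≠ b → σ a ≠ σ b := fun a b h => σ.injective.ne h
  have h1 := missing _ _ (hne 3 4 (by decide)) (image_missing σ hinv 3 4 missing34)
  have h2 := missing _ _ (hne 5 6 (by decide)) (image_missing σ hinv 5 6 missing56)
  have h35 := hne 3 5 (by decide)
  have h36 := hne 3 6 (by decide)
  have hlt : ∀ x : Fin 7, x ≠ 3 → x ≠ 4 → x ≠ 5 → x ≠ 6 → σ x < 3 :=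
    fun x e3 e4 e5 e6 => lt_three _ _ _ _ _ h1 h2 h35 h36
      (hne _ _ e3) (hne _ _ e4) (hne _ _ e5) (hne _ _ e6)
  obtain ⟨g, g3, g4, g5, g6⟩ := exists4 _ _ _ _ h1 h2 h35 h36
  obtain ⟨k, k0, k1, k2⟩ := exists3 (σ 0) (σ 1) (σ 2)
    (hlt 0 (by decide) (by decide) (by decide) (by decide))
    (hlt 1 (by decide) (by decide) (by decide) (by decide))
    (hlt 2 (by decide) (by decide) (by decide) (by decide))
    (hne _ _ (by decide)) (hne _ _ (by decide)) (hne _ _ (by decide))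
  obtain ⟨m0, m1, m2⟩ := fun3_maps k
  obtain ⟨f3, f4, f5, f6⟩ := fun3_fix k
  refine ⟨(g, k), ?_⟩
  rw [hom_apply]
  have all : ∀ x : Fin 7, x = 0 ∨ x = 1 ∨ x = 2 ∨ x = 3 ∨ x = 4 ∨ x = 5 ∨ x = 6 := by decide
  refine Equiv.ext fun x => ?_
  rw [Equiv.Perm.mul_apply]
  rcases all x with rfl | rfl | rfl | rfl | rfl | rfl | rfl
  · rw [fun4_fix_lt g _ m0, k0]
  · rw [fun4_fix_lt g _ m1, k1]
  · rw [fun4_fix_lt g _ m2, k2]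
  · rw [f3, g3]
  · rw [f4, g4]
  · rw [f5, g5]
  · rw [f6, g6]

end P73

/-- The facets of the triangulation `P⁷₃` of the 3-sphere on the seven
vertices `{1,…,7}` (here encoded as `Fin 7`, vertex `i` corresponding to `i−1`) are
`1246, 1256, 1257, 1247, 1346, 1356, 1357, 1347, 2346, 2356, 2357, 2347`. The group of
permutations of the vertices mapping every facet to a facet is isomorphic to the direct
product of the dihedral group of order 8 and the dihedral group of order 6; in particular
it has order 48. -/
theorem automorphism_group_P73 (F : Finset (Finset (Fin 7)))
    (hF : F = {({0, 1, 3, 5} : Finset (Fin 7)), {0, 1, 4, 5}, {0, 1, 4, 6},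
      {0, 1, 3, 6}, {0, 2, 3, 5}, {0, 2, 4, 5}, {0, 2, 4, 6}, {0, 2, 3, 6},
      {1, 2, 3, 5}, {1, 2, 4, 5}, {1, 2, 4, 6}, {1, 2, 3, 6}})
    (H : Subgroup (Equiv.Perm (Fin 7)))
    (hH : ∀ σ : Equiv.Perm (Fin 7), σ ∈ H ↔ ∀ s ∈ F, s.image σ ∈ F) :
    Nonempty (H ≃* DihedralGroup 4 × DihedralGroup 3) ∧ Nat.card H = 48 := by
  have hF' : F = P73.facets := hF
  subst hF'
  have hrange : P73.hom.range = H := by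
    ext σ
    constructor
    · rintro ⟨⟨a, b⟩, rfl⟩
      rw [P73.hom_apply]
      exact H.mul_mem ((hH _).2 (P73.fun4_mem a)) ((hH _).2 (P73.fun3_mem b))
    · intro hσ
      exact P73.mem_range σ ((hH _).1 (H.inv_mem hσ))
  subst hrange
  have e := (MonoidHom.ofInjective P73.hom_injective).symm
  refine ⟨⟨e⟩, ?_⟩
  rw [Nat.card_congr e.toEquiv, Nat.card_prod, DihedralGroup.nat_card, DihedralGroup.nat_card]
end

section
/- Let s ∈ ℂ and let M(s) be the skew-symmetric 7×7 matrix over ℂ[x_1,...,x_7] whose rows are: (0, 0, 0, x_7, −x_6, 0, −s x_4), (0, 0, s x_7, 0, x_5, −x_4, 0), (0, −s x_7, 0, s x_5, 0, x_3, −x_2), (−x_7, 0, −s x_5, 0, s x_3, 0, x_1), (x_6, −x_5, 0, −s x_3, 0, s x_1, 0), (0, x_4, −x_3, 0, −s x_1, 0, s x_6), (s x_4, 0, x_2, −x_1, 0, −s x_6, 0). Let p_1 = −x_1x_3x_5 + s²x_6x_5² + s²x_1²x_7 − s x_2x_3x_4 + s³x_3x_6x_7, p_2 = −x_1x_6x_3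 − s x_1x_2x_7 + s²x_3²x_4 + s²x_6²x_5 + s³x_1x_5x_4, p_3 = −x_1x_6x_4 + s²x_3x_4² − s x_6x_5x_7, p_4 = s³x_1x_4x_7 − x_2x_4x_6 − s x_3x_5x_4 + s²x_7x_6², p_5 = −x_2x_4x_7 + s²x_4²x_5 + s²x_6x_7², p_6 = s²x_5²x_4 − x_7x_2x_5 − s x_7x_1x_6 + s³x_3x_4x_7, p_7 = s²x_7²x_1 − x_3x_5x_7 − s x_4x_5x_6. Then there is a permutation σ of {1,...,7} such that for every i, the determinant of the 6×6 submatrix of M(s) obtained by deleting row i and column i equals p_{σ(i)}²; i.e. the polynomials p_1,...,p_7 are (up to sign) the principal Pfaffians of M(s). -/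
open MvPolynomial Matrix

set_option maxHeartbeats 4000000 in
/-- The determinant of a `6×6` alternating matrix is the square of its Pfaffian. -/
theorem det_six_eq_pfaffian_sq {R : Type*} [CommRing R] (A : Matrix (Fin 6) (Fin 6) R)
    (hd : ∀ i, A i i = 0) (hs : ∀ i j, i < j → A j i = -A i j) :
    A.det = (A 0 1 * A 2 3 * A 4 5 - A 0 1 * A 2 4 * A 3 5 + A 0 1 * A 2 5 * A 3 4 - A 0 2 * A 1 3
        * A 4 5 + A 0 2 * A 1 4 * A 3 5 - A 0 2 * A 1 5 * A 3 4 + A 0 3 * A 1 2 * A 4 5 - A 0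
        3 * A 1 4 * A 2 5 + A 0 3 * A 1 5 * A 2 4 - A 0 4 * A 1 2 * A 3 5 + A 0 4 * A 1 3 * A
        2 5 - A 0 4 * A 1 5 * A 2 3 + A 0 5 * A 1 2 * A 3 4 - A 0 5 * A 1 3 * A 2 4 + A 0 5 *
        A 1 4 * A 2 3) ^ 2 := by
  have hA : A = !![0, A 0 1, A 0 2, A 0 3, A 0 4, A 0 5;
        -A 0 1, 0, A 1 2, A 1 3, A 1 4, A 1 5;
        -A 0 2, -A 1 2, 0, A 2 3, A 2 4, A 2 5;
        -A 0 3, -A 1 3, -A 2 3, 0, A 3 4, A 3 5;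
        -A 0 4, -A 1 4, -A 2 4, -A 3 4, 0, A 4 5;
        -A 0 5, -A 1 5, -A 2 5, -A 3 5, -A 4 5, 0] := by
    ext i j
    fin_cases i <;> fin_cases j <;> first | exact hd _ | rfl | exact hs _ _ (by decide)
  generalize A 0 1 = a01, A 0 2 = a02, A 0 3 = a03, A 0 4 = a04, A 0 5 = a05,
    A 1 2 = a12, A 1 3 = a13, A 1 4 = a14, A 1 5 = a15, A 2 3 = a23, A 2 4 = a24,
    A 2 5 = a25, A 3 4 = a34, A 3 5 = a35, A 4 5 = a45 at hA ⊢
  subst hA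
  simp [Matrix.det_succ_row_zero, Fin.sum_univ_succ, Fin.succAbove]
  ring

set_option maxHeartbeats 1000000 in
/-- Over `ℂ[x₁,…,x₇]` (variables indexed by `Fin 7`, `xⱼ = X (j−1)`), the
skew-symmetric `7×7` syzygy matrix `M(s)` of the one-parameter Rødland subfamily has the
polynomials `p₁,…,p₇` as its principal Pfaffians up to sign and reordering: there is a
permutation `σ` such that deleting row `i` and column `i` of `M(s)` yields a matrix whose
determinant is `p_{σ(i)}²`. -/
theorem roedland_principal_pfaffians (s : ℂ)
    (M : Matrix (Fin 7) (Fin 7) (MvPolynomial (Fin 7) ℂ))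
    (hM : M = !![0, 0, 0, X 6, -X 5, 0, -(C s * X 3);
                 0, 0, C s * X 6, 0, X 4, -X 3, 0;
                 0, -(C s * X 6), 0, C s * X 4, 0, X 2, -X 1;
                 -X 6, 0, -(C s * X 4), 0, C s * X 2, 0, X 0;
                 X 5, -X 4, 0, -(C s * X 2), 0, C s * X 0, 0;
                 0, X 3, -X 2, 0, -(C s * X 0), 0, C s * X 5;
                 C s * X 3, 0, X 1, -X 0, 0, -(C s * X 5), 0])
    (p : Fin 7 → MvPolynomial (Fin 7) ℂ)
    (hp : p = ![
      -(X 0 * X 2 * X 4) + C (s ^ 2) * (X 5 * X 4 ^ 2) + C (s ^ 2) * (X 0 ^ 2 * X 6)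
        - C s * (X 1 * X 2 * X 3) + C (s ^ 3) * (X 2 * X 5 * X 6),
      -(X 0 * X 5 * X 2) - C s * (X 0 * X 1 * X 6) + C (s ^ 2) * (X 2 ^ 2 * X 3)
        + C (s ^ 2) * (X 5 ^ 2 * X 4) + C (s ^ 3) * (X 0 * X 4 * X 3),
      -(X 0 * X 5 * X 3) + C (s ^ 2) * (X 2 * X 3 ^ 2) - C s * (X 5 * X 4 * X 6),
      C (s ^ 3) * (X 0 * X 3 * X 6) - X 1 * X 3 * X 5 - C s * (X 2 * X 4 * X 3)
        + C (s ^ 2) * (X 6 * X 5 ^ 2),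
      -(X 1 * X 3 * X 6) + C (s ^ 2) * (X 3 ^ 2 * X 4) + C (s ^ 2) * (X 5 * X 6 ^ 2),
      C (s ^ 2) * (X 4 ^ 2 * X 3) - X 6 * X 1 * X 4 - C s * (X 6 * X 0 * X 5)
        + C (s ^ 3) * (X 2 * X 3 * X 6),
      C (s ^ 2) * (X 6 ^ 2 * X 0) - X 2 * X 4 * X 6 - C s * (X 3 * X 4 * X 5)]) :
    ∃ σ : Equiv.Perm (Fin 7), ∀ i : Fin 7,
      (M.submatrix i.succAbove i.succAbove).det = p (σ i) ^ 2 := by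
  refine ⟨1, fun i => ?_⟩
  have hd : ∀ i, M i i = 0 := by
    subst hM; intro i; fin_cases i <;> rfl
  have hs : ∀ i j, i < j → M j i = -M i j := by
    subst hM; intro i j hij
    fin_cases i <;> fin_cases j <;> first | (exact absurd hij (by decide)) | simp
  rw [det_six_eq_pfaffian_sq (M.submatrix i.succAbove i.succAbove) (fun _ => hd _)
    (fun a b hab => hs _ _ (Fin.strictMono_succAbove i hab))]
  clear hd hs
  subst hM hp
  fin_cases i <;> simp [Fin.succAbove, Matrix.submatrix_apply] <;> ring
end
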